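/- arXiv:0704.3304 — 2 statements merged into one kernel-verified Lean document; each statement's English description precedes it below -/
import Mathlib

section
/- For 0 < α ≤ 1 and λ ∈ (0, (1-α)/(1+α)], the characteristic function ψ(t) = Q(max(1-|t|,0)), where Q(s) = (1-(1-s)^α)/(1-λ(1-s)^α), satisfies ψ(t) = (1-|t|^α)/(1-λ|t|^α) for |t| ≤ 1 and ψ(t) = 0 for |t| ≥ 1, and ψ is a characteristic function of a probability distribution on ℝ. -/
open MeasureTheory Set

/-- The characteristic function of a measure `μ` on `ℝ`. -/
noncomputable def cf (μ : Measure ℝ) (t : ℝ) : ℂ :=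
  ∫ x, Complex.exp (t * x * Complex.I) ∂μ

/-- `φ` is the characteristic function of some probability distribution on `ℝ`. -/
def IsCF (φ : ℝ → ℂ) : Prop :=
  ∃ μ : Measure ℝ, IsProbabilityMeasure μ ∧ φ = cf μ

/-- `φ` is the characteristic function of an infinitely divisible distribution on `ℝ`. -/
def IsIDCF (φ : ℝ → ℂ) : Prop :=
  ∀ n : ℕ, 0 < n → ∃ ψ : ℝ → ℂ, IsCF ψ ∧ ∀ t, φ t = ψ t ^ n

/-- `P` is the probability generating function of a distribution on `{0,1,2,...}`:
on `[0,1]` it is given by a power series with nonnegative coefficients summing to `1`. -/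
def IsPGF (P : ℝ → ℝ) : Prop :=
  ∃ p : ℕ → ℝ, (∀ n, 0 ≤ p n) ∧ (∑' n, p n) = 1 ∧
    ∀ s ∈ Icc (0:ℝ) 1, P s = ∑' n, p n * s ^ n

/-- `P` is the PGF of an infinitely divisible distribution on `{0,1,2,...}`:
for every `n ≥ 1`, its `n`-th root (on `[0,1]`) is again a PGF. -/
def IsIDPGF (P : ℝ → ℝ) : Prop :=
  ∀ n : ℕ, 0 < n → ∃ Q : ℝ → ℝ, IsPGF Q ∧ ∀ s ∈ Icc (0:ℝ) 1, P s = Q s ^ n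


noncomputable def triF (t : ℝ) : ℝ := max (1 - |t|) 0
noncomputable def triP (x : ℝ) : ℝ := (1 - Real.cos (2 * Real.pi * x)) / (2 * Real.pi ^ 2 * x ^ 2)

lemma triF_cont : Continuous triF := by unfold triF; fun_prop

lemma triF_out {t : ℝ} (h : 1 ≤ |t|) : triF t = 0 := by
  unfold triF; rw [max_eq_right]; linarith

lemma triF_int : Integrable (fun t => (triF t : ℂ)) := by
  have : Continuous (fun t => (triF t : ℂ)) := by have := triF_cont; fun_prop
  apply this.integrable_of_hasCompactSupport
  apply HasCompactSupport.intro (K := Icc (-1) 1) isCompact_Icc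
  intro x hx
  have : 1 ≤ |x| := by
    by_contra h
    push Not at h
    exact hx ⟨(abs_lt.1 h).1.le, (abs_lt.1 h).2.le⟩
  simp [triF_out this]

lemma tri_half (a : ℂ) (ha : a ≠ 0) :
    ∫ t in (0:ℝ)..1, ((1 - t : ℝ) : ℂ) * Complex.exp (a * t) =
      Complex.exp a / a ^ 2 - 1 / a - 1 / a ^ 2 := by
  have h : ∀ t : ℝ, HasDerivAt (fun t : ℝ => Complex.exp (a * t) * ((1 - t) / a + 1 / a ^ 2))
      (((1 - t : ℝ) : ℂ) * Complex.exp (a * t)) t := by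
    intro t
    have h0 : HasDerivAt (fun t : ℝ => (t : ℂ)) 1 t := Complex.ofRealCLM.hasDerivAt
    have h1 := ((h0.const_mul a).cexp).mul (((h0.const_sub 1).div_const a).add_const (1 / a ^ 2))
    refine h1.congr_deriv ?_
    push_cast
    field_simp
    ring
  rw [intervalIntegral.integral_eq_sub_of_hasDerivAt (fun t _ => h t)
    (Continuous.intervalIntegrable (by fun_prop) _ _)]
  simp
  field_simp
  ring

lemma tri_fourier (x : ℝ) (hx : x ≠ 0) :
    FourierTransform.fourier (fun t => (triF t : ℂ)) x = (triP x : ℂ) := by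
  rw [Real.fourier_real_eq_integral_exp_smul]
  set a : ℂ := ((-2 * Real.pi * x : ℝ) : ℂ) * Complex.I with ha
  have ha0 : a ≠ 0 := by simp [ha, hx, Real.pi_ne_zero]
  have e : ∀ v : ℝ, Complex.exp (↑(-2 * Real.pi * v * x) * Complex.I) • (triF v : ℂ)
      = (triF v : ℂ) * Complex.exp (a * v) := by
    intro v
    rw [smul_eq_mul, mul_comm]; congr 2; rw [ha]; push_cast; ring
  simp_rw [e]
  have hc : Continuous (fun v : ℝ => (triF v : ℂ) * Complex.exp (a * v)) := by
    have := triF_cont; fun_prop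
  rw [← setIntegral_eq_integral_of_forall_compl_eq_zero (s := Ioc (-1) 1),
    ← intervalIntegral.integral_of_le (by norm_num),
    ← intervalIntegral.integral_add_adjacent_intervals (b := 0)
      (hc.intervalIntegrable _ _) (hc.intervalIntegrable _ _)]
  · have h1 : ∫ t in (0:ℝ)..1, (triF t : ℂ) * Complex.exp (a * t) =
        ∫ t in (0:ℝ)..1, ((1 - t : ℝ) : ℂ) * Complex.exp (a * t) := by
      apply intervalIntegral.integral_congr
      intro t ht
      rw [uIcc_of_le (by norm_num)] at ht
      have : triF t = 1 - t := by
        unfold triF; rw [abs_of_nonneg ht.1, max_eq_left]; linarith [ht.2]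
      simp only [this]
    have h2 : ∫ t in (-1:ℝ)..0, (triF t : ℂ) * Complex.exp (a * t) =
        ∫ t in (0:ℝ)..1, ((1 - t : ℝ) : ℂ) * Complex.exp (-a * t) := by
      have := intervalIntegral.integral_comp_neg (a := 0) (b := 1)
        (fun t : ℝ => (triF t : ℂ) * Complex.exp (a * t))
      rw [neg_zero] at this
      rw [← this]
      apply intervalIntegral.integral_congr
      intro t ht
      rw [uIcc_of_le (by norm_num)] at ht
      have : triF (-t) = 1 - t := by
        unfold triF; rw [abs_neg, abs_of_nonneg ht.1, max_eq_left]; linarith [ht.2]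
      simp [this]
    rw [h1, h2, tri_half a ha0, tri_half (-a) (neg_ne_zero.2 ha0)]
    have h3 : Complex.exp a + Complex.exp (-a) = 2 * (Real.cos (2 * Real.pi * x) : ℂ) := by
      have := Complex.two_cos (((-2 * Real.pi * x : ℝ) : ℂ))
      rw [Complex.ofReal_cos, ← Complex.cos_neg, ha, ← neg_mul, ← this]
      congr 2; push_cast; ring
    have h4 : a ^ 2 = -(4 * Real.pi ^ 2 * x ^ 2) := by
      rw [ha, mul_pow, Complex.I_sq]; push_cast; ring
    have h5 : Complex.exp (-a) / (-a) ^ 2 - 1 / (-a) - 1 / (-a) ^ 2 +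
        (Complex.exp a / a ^ 2 - 1 / a - 1 / a ^ 2) =
        (Complex.exp a + Complex.exp (-a) - 2) / a ^ 2 := by
      field_simp; ring
    rw [h5, h3, h4, triP]
    have hxx : (x : ℂ) ≠ 0 := by exact_mod_cast hx
    have hpp : (Real.pi : ℂ) ≠ 0 := by exact_mod_cast Real.pi_ne_zero
    push_cast
    field_simp
    ring
  · intro t ht
    have : 1 ≤ |t| := by
      by_contra h
      push Not at h
      exact ht ⟨(abs_lt.1 h).1, (abs_lt.1 h).2.le⟩
    simp [triF_out this]

lemma triP_nonneg (x : ℝ) : 0 ≤ triP x := by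
  unfold triP
  have := Real.cos_le_one (2 * Real.pi * x)
  apply div_nonneg <;> [linarith; positivity]

lemma triP_meas : Measurable triP := by unfold triP; fun_prop

lemma triP_int : Integrable triP := by
  apply (integrable_inv_one_add_sq.const_mul 2).mono' triP_meas.aestronglyMeasurable
  refine Filter.Eventually.of_forall fun x => ?_
  rw [Real.norm_of_nonneg (triP_nonneg x)]
  rcases eq_or_ne x 0 with rfl | hx
  · simp [triP]
  have h1 := Real.one_sub_sq_div_two_le_cos (x := 2 * Real.pi * x)
  have h2 := Real.neg_one_le_cos (2 * Real.pi * x)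
  have hx2 : 0 < x ^ 2 := by positivity
  have hp := Real.pi_gt_three
  have hp2 : 1 ≤ Real.pi ^ 2 := by nlinarith
  unfold triP
  rw [← div_eq_mul_inv, div_le_div_iff₀ (by positivity) (by positivity)]
  nlinarith [mul_le_mul_of_nonneg_right hp2 hx2.le, mul_nonneg hx2.le (by linarith : 0 ≤ 1 + Real.cos (2 * Real.pi * x))]

lemma tri_inv (t : ℝ) :
    ∫ x, Complex.exp (((2 * Real.pi * x * t : ℝ) : ℂ) * Complex.I) * (triP x : ℂ) = (triF t : ℂ) := by
  have hae : FourierTransform.fourier (fun t => (triF t : ℂ)) =ᵐ[volume] fun x => (triP x : ℂ) := by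
    filter_upwards [compl_mem_ae_iff.2 (measure_singleton (0:ℝ))] with x hx
    exact tri_fourier x hx
  have hint : Integrable (FourierTransform.fourier (fun t => (triF t : ℂ))) :=
    (integrable_congr hae).2 triP_int.ofReal
  have hc : Continuous (fun t => (triF t : ℂ)) := by have := triF_cont; fun_prop
  have := congrFun (hc.fourierInv_fourier_eq triF_int hint) t
  rw [Real.fourierInv_eq'] at this
  rw [← this]
  apply integral_congr_ae
  filter_upwards [hae] with x hx
  rw [hx, smul_eq_mul]
  congr 2
  simp
  ring

noncomputable def triM : Measure ℝ := volume.withDensity (fun x => ENNReal.ofReal (triP x))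

lemma triM_cf (t : ℝ) :
    ∫ x, Complex.exp (((2 * Real.pi * x * t : ℝ) : ℂ) * Complex.I) ∂triM = (triF t : ℂ) := by
  rw [triM, integral_withDensity_eq_integral_toReal_smul triP_meas.ennreal_ofReal (by simp),
    ← tri_inv t]
  congr 1; ext x
  rw [ENNReal.toReal_ofReal (triP_nonneg x), Complex.real_smul, mul_comm]

instance triM_fin : IsFiniteMeasure triM :=
  isFiniteMeasure_withDensity_ofReal triP_int.2

/-- mixture -/
lemma mix_cf (ν : Measure ℝ) [IsFiniteMeasure ν] (ψ : ℝ → ℝ) (h0 : ψ 0 = 1)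
    (h : ∀ t, ∫ r, triF (t / r) ∂ν = ψ t) :
    ∃ μ : Measure ℝ, IsProbabilityMeasure μ ∧ (fun t => (ψ t : ℂ)) =
      fun t : ℝ => ∫ x, Complex.exp (t * x * Complex.I) ∂μ := by
  have hm : Measurable (fun p : ℝ × ℝ => 2 * Real.pi * p.2 / p.1) := by fun_prop
  have key : ∀ t : ℝ, ∫ x, Complex.exp (t * x * Complex.I)
      ∂((ν.prod triM).map (fun p : ℝ × ℝ => 2 * Real.pi * p.2 / p.1)) = ψ t := by
    intro t
    rw [integral_map hm.aemeasurable (by fun_prop), integral_prod]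
    · rw [← h t, ← integral_complex_ofReal]
      congr 1; ext r
      rw [← triM_cf]
      congr 1; ext x
      congr 2; push_cast; ring
    · apply Integrable.of_bound (C := 1)
      · apply Measurable.aestronglyMeasurable
        fun_prop
      · refine Filter.Eventually.of_forall fun p => ?_
        rw [← Complex.ofReal_mul, Complex.norm_exp_ofReal_mul_I]
  refine ⟨_, ?_, funext fun t => (key t).symm⟩
  have := key 0
  simp [h0] at this
  constructor
  rw [← ENNReal.toReal_eq_one_iff]
  exact_mod_cast this

section polya
variable (a l : ℝ)

noncomputable def pg (r : ℝ) : ℝ := (1 - r ^ a) / (1 - l * r ^ a)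
noncomputable def pk (r : ℝ) : ℝ := a * (1 - l) * r ^ a / (r * (1 - l * r ^ a) ^ 2)
noncomputable def pF (r : ℝ) : ℝ := a * (1 - l) * r ^ a / (1 - l * r ^ a) ^ 2 + pg a l r
noncomputable def pd (r : ℝ) : ℝ :=
  a * (1 - l) * r ^ a / (r * (1 - l * r ^ a) ^ 3) * ((1 - a) - (1 + a) * l * r ^ a)

end polya

lemma p_w {a : ℝ} (ha : 0 < a) {r : ℝ} (h0 : 0 ≤ r) (h1 : r ≤ 1) : 0 ≤ r ^ a ∧ r ^ a ≤ 1 :=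
  ⟨Real.rpow_nonneg h0 a, Real.rpow_le_one h0 h1 ha.le⟩

lemma p_den {a l : ℝ} (ha : 0 < a) (hl0 : 0 < l) (hl : l < 1) {r : ℝ} (h0 : 0 ≤ r) (h1 : r ≤ 1) :
    0 < 1 - l * r ^ a := by
  have := p_w ha h0 h1
  nlinarith

lemma pd_nonneg {a l : ℝ} (ha : 0 < a) (hl0 : 0 < l) (hl : l < 1) (hc : l * (1 + a) ≤ 1 - a)
    {r : ℝ} (h0 : 0 ≤ r) (h1 : r ≤ 1) : 0 ≤ pd a l r := by
  have hd := p_den ha hl0 hl h0 h1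
  obtain ⟨w0, w1⟩ := p_w ha h0 h1
  have : 0 ≤ 1 - l := by linarith
  unfold pd
  refine mul_nonneg (by positivity) ?_
  nlinarith [mul_nonneg (mul_nonneg hl0.le (by linarith : 0 ≤ 1 + a)) (sub_nonneg.2 w1)]

lemma pH_deriv {a l : ℝ} (ha : 0 < a) (hl0 : 0 < l) (hl : l < 1) (t : ℝ)
    {r : ℝ} (h0 : 0 < r) (h1 : r ≤ 1) :
    HasDerivAt (fun r => t * pk a l r - pF a l r) (pd a l r * (1 - t / r)) r := by
  have hd := (p_den ha hl0 hl h0.le h1).ne'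
  have hw : HasDerivAt (fun r : ℝ => r ^ a) (a * r ^ a / r) r := by
    have := Real.hasDerivAt_rpow_const (x := r) (p := a) (Or.inl h0.ne')
    rw [Real.rpow_sub_one h0.ne'] at this
    exact this.congr_deriv (by ring)
  have hD : HasDerivAt (fun r : ℝ => 1 - l * r ^ a) (-(l * (a * r ^ a / r))) r :=
    (hw.const_mul l).const_sub 1
  have hg : HasDerivAt (pg a l) _ r := (hw.const_sub 1).div hD hd
  have hk : HasDerivAt (pk a l) _ r :=
    (hw.const_mul (a * (1 - l))).div ((hasDerivAt_id r).mul (hD.pow 2))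
      (mul_ne_zero h0.ne' (pow_ne_zero 2 hd))
  have hF : HasDerivAt (pF a l) _ r :=
    ((hw.const_mul (a * (1 - l))).div (hD.pow 2) (pow_ne_zero 2 hd)).add hg
  refine ((hk.const_mul t).sub hF).congr_deriv ?_
  unfold pd
  simp only [Pi.pow_apply, Pi.mul_apply, id]
  generalize r ^ a = w at *
  have h0' := h0.ne'
  field_simp
  push_cast
  ring

lemma pH_cont {a l : ℝ} (ha : 0 < a) (hl0 : 0 < l) (hl : l < 1) {t : ℝ} (ht : 0 ≤ t) :
    ContinuousOn (fun r => t * pk a l r - pF a l r) (Icc t 1) := by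
  have hw : ContinuousOn (fun r : ℝ => r ^ a) (Icc t 1) :=
    (Real.continuous_rpow_const ha.le).continuousOn
  have hne : ∀ r ∈ Icc t 1, 1 - l * r ^ a ≠ 0 := fun r hr =>
    (p_den ha hl0 hl (ht.trans hr.1) hr.2).ne'
  apply ContinuousOn.sub
  · rcases ht.eq_or_lt with rfl | ht
    · simpa using continuousOn_const
    · unfold pk
      refine continuousOn_const.mul (ContinuousOn.div (by fun_prop) (by fun_prop) fun r hr => ?_)
      exact mul_ne_zero (ht.trans_le hr.1).ne' (pow_ne_zero 2 (hne r hr))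
  · unfold pF pg
    exact ContinuousOn.add (ContinuousOn.div (by fun_prop) (by fun_prop)
      fun r hr => pow_ne_zero 2 (hne r hr)) (ContinuousOn.div (by fun_prop) (by fun_prop) hne)

lemma pH_val {a l : ℝ} (ha : 0 < a) {t : ℝ} (ht : 0 ≤ t) : t * pk a l t - pF a l t = - pg a l t := by
  unfold pF pk
  rcases ht.eq_or_lt with rfl | ht
  · simp [Real.zero_rpow ha.ne']
  · field_simp
    ring

lemma p_integrable {a l : ℝ} (ha : 0 < a) (hl0 : 0 < l) (hl : l < 1) (hc : l * (1 + a) ≤ 1 - a)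
    {t : ℝ} (ht : 0 ≤ t) : IntegrableOn (fun r => pd a l r * (1 - t / r)) (Ioc t 1) := by
  apply intervalIntegral.integrableOn_deriv_of_nonneg (pH_cont ha hl0 hl ht)
  · intro r hr
    exact pH_deriv ha hl0 hl t (ht.trans_lt hr.1) hr.2.le
  · intro r hr
    have hr0 := ht.trans_lt hr.1
    refine mul_nonneg (pd_nonneg ha hl0 hl hc hr0.le hr.2.le) ?_
    rw [sub_nonneg, div_le_one hr0]; exact hr.1.le

lemma p_integral {a l : ℝ} (ha : 0 < a) (hl0 : 0 < l) (hl : l < 1) (hc : l * (1 + a) ≤ 1 - a)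
    {t : ℝ} (ht : 0 ≤ t) (ht1 : t ≤ 1) :
    ∫ r in Ioc t 1, pd a l r * (1 - t / r) = pg a l t - pk a l 1 * (1 - t) := by
  rw [← intervalIntegral.integral_of_le ht1,
    intervalIntegral.integral_eq_sub_of_hasDerivAt_of_le ht1 (pH_cont ha hl0 hl ht)
      (fun r hr => pH_deriv ha hl0 hl t (ht.trans_lt hr.1) hr.2.le)
      ((intervalIntegrable_iff_integrableOn_Ioc_of_le ht1).2 (p_integrable ha hl0 hl hc ht)),
    pH_val ha ht]
  simp [pF, pk, pg]
  ring

noncomputable def pnu (a l : ℝ) : Measure ℝ :=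
  (volume.restrict (Ioc 0 1)).withDensity (fun r => ENNReal.ofReal (pd a l r)) +
    ENNReal.ofReal (pk a l 1) • Measure.dirac 1

lemma pd_integrable {a l : ℝ} (ha : 0 < a) (hl0 : 0 < l) (hl : l < 1) (hc : l * (1 + a) ≤ 1 - a) :
    IntegrableOn (pd a l) (Ioc 0 1) := by
  simpa using p_integrable ha hl0 hl hc le_rfl

lemma pnu_fin {a l : ℝ} (ha : 0 < a) (hl0 : 0 < l) (hl : l < 1) (hc : l * (1 + a) ≤ 1 - a) :
    IsFiniteMeasure (pnu a l) := by
  have h1 : IsFiniteMeasure ((volume.restrict (Ioc (0:ℝ) 1)).withDensity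
    (fun r => ENNReal.ofReal (pd a l r))) :=
    isFiniteMeasure_withDensity_ofReal (pd_integrable ha hl0 hl hc).2
  have h2 : IsFiniteMeasure (ENNReal.ofReal (pk a l 1) • Measure.dirac (1:ℝ)) :=
    Measure.smul_finite _ ENNReal.ofReal_ne_top
  unfold pnu
  infer_instance

lemma triF_nonneg (t : ℝ) : 0 ≤ triF t := le_max_right _ _
lemma triF_le (t : ℝ) : triF t ≤ 1 := max_le (by linarith [abs_nonneg t]) zero_le_one

lemma pnu_int {a l : ℝ} (ha : 0 < a) (hl0 : 0 < l) (hl : l < 1) (hc : l * (1 + a) ≤ 1 - a) (t : ℝ) :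
    ∫ r, triF (t / r) ∂(pnu a l) = pg a l (1 - triF t) := by
  have hfin := pnu_fin ha hl0 hl hc
  have hmeas : Measurable (fun r => triF (t / r)) := triF_cont.measurable.comp (by fun_prop)
  have hI : Integrable (fun r => triF (t / r)) (pnu a l) := by
    apply Integrable.of_bound (C := 1) hmeas.aestronglyMeasurable
    refine Filter.Eventually.of_forall fun r => ?_
    rw [Real.norm_of_nonneg (triF_nonneg _)]; exact triF_le _
  have hk : 0 ≤ pk a l 1 := by
    have : 0 ≤ 1 - l := by linarith
    unfold pk; simp only [Real.one_rpow]; positivity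
  have hpm : Measurable (pd a l) := by unfold pd; fun_prop
  unfold pnu at hI ⊢
  rw [integral_add_measure hI.left_of_add_measure hI.right_of_add_measure,
    integral_smul_measure, integral_dirac, ENNReal.toReal_ofReal hk,
    integral_withDensity_eq_integral_toReal_smul hpm.ennreal_ofReal (by simp), div_one]
  have e1 : ∫ r in Ioc (0:ℝ) 1, (ENNReal.ofReal (pd a l r)).toReal • triF (t / r)
      = ∫ r in Ioc (0:ℝ) 1, pd a l r * triF (t / r) := by
    apply setIntegral_congr_fun measurableSet_Ioc
    intro r hr
    simp only [smul_eq_mul]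
    rw [ENNReal.toReal_ofReal (pd_nonneg ha hl0 hl hc hr.1.le hr.2)]
  have hout : ∀ r ∈ Ioc (0:ℝ) 1, r ≤ |t| → triF (t / r) = 0 := by
    intro r hr h
    apply triF_out
    rw [abs_div, abs_of_pos hr.1, one_le_div hr.1]; exact h
  rw [e1]
  rcases le_total |t| 1 with h | h
  · have ht : triF t = 1 - |t| := by unfold triF; rw [max_eq_left]; linarith
    have e2 : ∫ r in Ioc (0:ℝ) 1, pd a l r * triF (t / r)
        = ∫ r in Ioc |t| 1, pd a l r * triF (t / r) := by
      apply setIntegral_eq_of_subset_of_forall_sdiff_eq_zero measurableSet_Ioc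
        (Ioc_subset_Ioc_left (abs_nonneg t))
      intro r hr
      rw [hout r hr.1, mul_zero]
      by_contra h'
      push Not at h'
      exact hr.2 ⟨h', hr.1.2⟩
    have e3 : ∫ r in Ioc |t| 1, pd a l r * triF (t / r)
        = ∫ r in Ioc |t| 1, pd a l r * (1 - |t| / r) := by
      apply setIntegral_congr_fun measurableSet_Ioc
      intro r hr
      have hr0 : 0 < r := (abs_nonneg t).trans_lt hr.1
      simp only
      unfold triF
      rw [abs_div, abs_of_pos hr0, max_eq_left]
      rw [sub_nonneg, div_le_one hr0]; exact hr.1.le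
    rw [e2, e3, p_integral ha hl0 hl hc (abs_nonneg t) h, ht, smul_eq_mul]
    ring_nf
  · rw [triF_out h, setIntegral_eq_zero_of_forall_eq_zero]
    · simp [pg]
    · intro r hr
      rw [hout r hr (hr.2.trans h), mul_zero]

/-- For `0 < α ≤ 1` and `0 < λ ≤ (1-α)/(1+α)`, `ψ(t) = Q(max(1-|t|,0))` with
`Q(s) = (1-(1-s)^α)/(1-λ(1-s)^α)` satisfies `ψ(t) = (1-|t|^α)/(1-λ|t|^α)` for
`|t| ≤ 1`, `ψ(t) = 0` for `|t| ≥ 1`, and is a characteristic function. -/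
theorem stmt9 (α lam : ℝ) (hα0 : 0 < α) (hα1 : α ≤ 1) (hl0 : 0 < lam)
    (hl1 : lam ≤ (1 - α) / (1 + α)) :
    let Q : ℝ → ℝ := fun s => (1 - (1 - s) ^ α) / (1 - lam * (1 - s) ^ α)
    let ψ : ℝ → ℝ := fun t => Q (max (1 - |t|) 0)
    (∀ t : ℝ, |t| ≤ 1 → ψ t = (1 - |t| ^ α) / (1 - lam * |t| ^ α)) ∧
    (∀ t : ℝ, 1 ≤ |t| → ψ t = 0) ∧
    IsCF fun t => ((ψ t : ℝ) : ℂ) := by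
  intro Q ψ
  have ha1 : 0 < 1 + α := by linarith
  rw [le_div_iff₀ ha1] at hl1
  have hl : lam < 1 := by nlinarith
  have hψ : ∀ t, ψ t = pg α lam (1 - triF t) := fun t => rfl
  refine ⟨fun t ht => ?_, fun t ht => ?_, ?_⟩
  · have : triF t = 1 - |t| := by unfold triF; rw [max_eq_left]; linarith
    rw [hψ, this, sub_sub_cancel]; rfl
  · rw [hψ, triF_out ht]; simp [pg]
  · have := pnu_fin hα0 hl0 hl hl1
    refine mix_cf (pnu α lam) ψ ?_ fun t => pnu_int hα0 hl0 hl hl1 t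
    rw [hψ]
    simp [triF, pg, Real.zero_rpow hα0.ne']
end

section
/- Any distribution on ℝ that is semi-selfdecomposable(b) in the Maejima–Naito sense (φ(t) = φ(bt)φ_0(t) for some b ∈ (0,1) and some infinitely divisible characteristic function φ_0) is itself infinitely divisible. -/
open MeasureTheory Set

lemma cf_eq_charFun (μ : Measure ℝ) : cf μ = charFun μ := by
  funext t
  rw [charFun_apply_real]; rfl

lemma exists_convPow (ν : Measure ℝ) [IsProbabilityMeasure ν] (m : ℕ) :
    ∃ ρ : Measure ℝ, IsProbabilityMeasure ρ ∧ (∀ t, charFun ρ t = charFun ν t ^ (m + 1)) ∧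
      ∀ S : Set ℝ, MeasurableSet S → (∀ x ∈ S, ∀ y ∈ S, x + y ∈ S) →
        ν S ^ (m + 1) ≤ ρ S := by
  induction m with
  | zero => exact ⟨ν, inferInstance, by simp, by simp⟩
  | succ m ih =>
    obtain ⟨ρ, hρ, h1, h2⟩ := ih
    refine ⟨ρ.conv ν, inferInstance, fun t => ?_, fun S hS hadd => ?_⟩
    · rw [charFun_conv, h1, pow_succ _ (m + 1)]
    · rw [pow_succ]
      calc ν S ^ (m + 1) * ν S ≤ ρ S * ν S := by gcongr; exact h2 S hS hadd
        _ = (ρ.prod ν) (S ×ˢ S) := (Measure.prod_prod _ _).symm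
        _ ≤ (ρ.prod ν) ((fun p : ℝ × ℝ => p.1 + p.2) ⁻¹' S) := by
            apply measure_mono
            rintro ⟨x, y⟩ ⟨hx, hy⟩
            exact hadd x hx y hy
        _ = (ρ.conv ν) S := by
            rw [Measure.conv, Measure.map_apply (by fun_prop) hS]

open Filter Topology in
lemma tight_root (m : ℕ) (ν ρ : ℕ → Measure ℝ)
    (h : ∀ k, ∀ S : Set ℝ, MeasurableSet S → (∀ x ∈ S, ∀ y ∈ S, x + y ∈ S) →
        ν k S ^ (m + 1) ≤ ρ k S)
    (hρ : IsTightMeasureSet (Set.range ρ)) : IsTightMeasureSet (Set.range ν) := by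
  rw [isTightMeasureSet_iff_exists_isCompact_measure_compl_le] at hρ ⊢
  intro ε hε
  obtain ⟨K, hK, hKε⟩ := hρ ((ε / 2) ^ (m + 1)) (ENNReal.pow_pos (ENNReal.half_pos hε.ne') _)
  obtain ⟨r, hr⟩ := hK.isBounded.subset_closedBall 0
  refine ⟨Icc (-(max r 0)) (max r 0), isCompact_Icc, ?_⟩
  rintro _ ⟨k, rfl⟩
  have key : ∀ S : Set ℝ, MeasurableSet S → (∀ x ∈ S, ∀ y ∈ S, x + y ∈ S) →
      (S ⊆ Kᶜ) → ν k S ≤ ε / 2 := by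
    intro S hS ha hsub
    have : ν k S ^ (m + 1) ≤ (ε / 2) ^ (m + 1) :=
      (h k S hS ha).trans ((measure_mono hsub).trans (hKε _ ⟨k, rfl⟩))
    exact (ENNReal.pow_le_pow_left_iff (Nat.succ_ne_zero m)).1 this
  have hr' : ∀ x ∈ K, -(max r 0) ≤ x ∧ x ≤ max r 0 := by
    intro x hx
    have := hr hx
    rw [Metric.mem_closedBall, dist_zero_right, Real.norm_eq_abs, abs_le] at this
    have := le_max_left r 0
    constructor <;> linarith
  have h0 := le_max_right r 0
  have e1 : ν k (Ioi (max r 0)) ≤ ε / 2 := by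
    refine key _ measurableSet_Ioi ?_ ?_
    · intro x hx y hy
      simp only [mem_Ioi] at *; linarith
    · intro x hx hxK
      exact absurd (hr' x hxK).2 (not_le.2 hx)
  have e2 : ν k (Iio (-(max r 0))) ≤ ε / 2 := by
    refine key _ measurableSet_Iio ?_ ?_
    · intro x hx y hy
      simp only [mem_Iio] at *; linarith
    · intro x hx hxK
      exact absurd (hr' x hxK).1 (not_le.2 hx)
  calc ν k (Icc (-(max r 0)) (max r 0))ᶜ
      ≤ ν k (Iio (-(max r 0)) ∪ Ioi (max r 0)) := by
        apply measure_mono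
        intro x hx
        by_contra hc
        simp only [mem_union, mem_Iio, mem_Ioi, not_or, not_lt] at hc
        exact hx ⟨hc.1, hc.2⟩
    _ ≤ ε / 2 + ε / 2 := (measure_union_le _ _).trans (add_le_add e2 e1)
    _ = ε := ENNReal.add_halves ε

lemma exists_partial (φ φ₀ : ℝ → ℂ) (b : ℝ) (n : ℕ) (σ : Measure ℝ) [IsProbabilityMeasure σ]
    (hσ : ∀ t, φ₀ t = charFun σ t ^ n) (h : ∀ t, φ t = φ (b * t) * φ₀ t) (k : ℕ) :
    ∃ ν : Measure ℝ, IsProbabilityMeasure ν ∧ ∀ t, φ t = φ (b ^ k * t) * charFun ν t ^ n := by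
  induction k with
  | zero => exact ⟨Measure.dirac 0, inferInstance, by simp [charFun_dirac]⟩
  | succ k ih =>
    obtain ⟨ν, hν, h1⟩ := ih
    have : IsProbabilityMeasure (σ.map (b ^ k * ·)) :=
      Measure.isProbabilityMeasure_map (by fun_prop)
    refine ⟨ν.conv (σ.map (b ^ k * ·)), inferInstance, fun t => ?_⟩
    rw [charFun_conv, charFun_map_mul, h1 t, h (b ^ k * t), hσ]
    rw [show b ^ (k + 1) * t = b * (b ^ k * t) by ring]
    ring

open Filter Topology in
theorem stmt19 (φ : ℝ → ℂ) (hφ : IsCF φ)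
    (h : ∃ b : ℝ, 0 < b ∧ b < 1 ∧
      ∃ φ₀ : ℝ → ℂ, IsIDCF φ₀ ∧ ∀ t, φ t = φ (b * t) * φ₀ t) :
    IsIDCF φ := by
  obtain ⟨b, hb0, hb1, φ₀, hid, hrel⟩ := h
  obtain ⟨μ, hμ, rfl⟩ := hφ
  intro n hn
  obtain ⟨m, rfl⟩ : ∃ m, n = m + 1 := ⟨n - 1, by omega⟩
  obtain ⟨_, ⟨σ, hσ, rfl⟩, hσ0⟩ := hid (m + 1) hn
  rw [cf_eq_charFun] at *
  choose ν hν hνφ using exists_partial (charFun μ) φ₀ b (m + 1) σ hσ0 hrel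
  choose ρ hρ hρν hρS using fun k => exists_convPow (ν k) m
  have hcont : Continuous (charFun μ) := continuous_charFun
  have hlim1 : ∀ t, Tendsto (fun k : ℕ => charFun μ (b ^ k * t)) atTop (𝓝 1) := by
    intro t
    have h1 : Tendsto (fun k : ℕ => b ^ k * t) atTop (𝓝 0) := by
      simpa using (tendsto_pow_atTop_nhds_zero_of_lt_one hb0.le hb1).mul_const t
    have h2 := (hcont.tendsto 0).comp h1
    simpa [charFun_zero, Function.comp_def] using h2
  have hlim : ∀ t, Tendsto (fun k => charFun (ρ k) t) atTop (𝓝 (charFun μ t)) := by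
    intro t
    have h1 : Tendsto (fun k : ℕ => charFun μ t / charFun μ (b ^ k * t)) atTop
        (𝓝 (charFun μ t)) := by
      have h2 := (tendsto_const_nhds (x := charFun μ t)).div (hlim1 t) one_ne_zero
      rw [div_one] at h2
      exact h2
    refine h1.congr' ?_
    filter_upwards [(hlim1 t).eventually_ne one_ne_zero] with k hk
    rw [hρν, div_eq_iff hk, mul_comm, ← hνφ]
  have htρ : IsTightMeasureSet (Set.range ρ) :=
    isTightMeasureSet_of_tendsto_charFun hcont.continuousAt hlim
  have htν := tight_root m ν ρ hρS htρ
  let P : ℕ → ProbabilityMeasure ℝ := fun k => ⟨ν k, hν k⟩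
  have hcomp : IsCompact (closure (Set.range P)) := by
    apply isCompact_closure_of_isTightMeasureSet
    apply htν.subset
    rintro _ ⟨_, ⟨k, rfl⟩, rfl⟩
    exact ⟨k, rfl⟩
  obtain ⟨τ, -, s, hs, hsτ⟩ := hcomp.isSeqCompact (fun k => subset_closure (mem_range_self k))
  rw [ProbabilityMeasure.tendsto_iff_tendsto_charFun] at hsτ
  refine ⟨cf τ, ⟨τ, inferInstance, rfl⟩, fun t => ?_⟩
  rw [cf_eq_charFun]
  refine tendsto_nhds_unique ((hlim t).comp hs.tendsto_atTop) ?_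
  refine ((hsτ t).pow (m + 1)).congr fun k => ?_
  simp only [Function.comp, hρν]
  rfl
end
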